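/- Let G be a finite group of exponent m, let Γ = SC(G, T₁₁, T₂₂, T₁₂, T₂₁) be a quasi-abelian semi-Cayley digraph, with I₁, I₂, I₃ as below, and let ζ ∈ ℂ be a primitive m-th root of unity. Let K be the subfield of ℂ generated over ℚ by all values χ(I₁) and χ(I₂ \ I₃) − χ(I₃ \ I₂), χ ranging over the irreducible complex characters of G, and let T = {t ∈ (ℤ/mℤ)ˣ : I₁^t = I₁, (I₂ \ I₃)^t = I₂ \ I₃, (I₃ \ I₂)^t = I₃ \ I₂}. Then K is contained in the cyclotomic field ℚ(ζ) ⊆ ℂ, the degree [ℚ(ζ) : K] equals |T|, and K = {x ∈ ℚ(ζ) : σ_t(x) = x for all t ∈ T}, where σ_t is the automorphism of ℚ(ζ) over ℚ with σ_t(ζ) = ζ^t. -/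

import Mathlib

open IntermediateField

/-- A finset of elements of a group is conjugation-closed if its image under
conjugation by any group element equals itself. -/
def ConjClosedF {G : Type*} [Group G] [DecidableEq G] (T : Finset G) : Prop :=
  ∀ g : G, T.image (fun x => g⁻¹ * x * g) = T

/-- The multiset of pairwise products `[x·y : x ∈ X, y ∈ Y]` of two multisets of a group. -/
def msProd {G : Type*} [Group G] (X Y : Multiset G) : Multiset G :=
  X.bind (fun x => Y.map (fun y => x * y))

/-- The `t`-th power map on multisets of a group, for `t` a unit modulo the exponent. -/
def msPow {G : Type*} [Group G] {m : ℕ} (t : (ZMod m)ˣ) (X : Multiset G) : Multiset G :=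
  X.map (fun x => x ^ ((t : ZMod m).val))

/-- `χ : G → ℂ` is an irreducible complex character of `G` if it is the trace function of
a nonzero irreducible finite-dimensional complex representation of `G`. -/
def IsIrrChar (G : Type*) [Group G] (χ : G → ℂ) : Prop :=
  ∃ (V : Type) (_ : AddCommGroup V) (_ : Module ℂ V) (_ : FiniteDimensional ℂ V)
    (_ : Nontrivial V) (ρ : Representation ℂ G V),
    (∀ W : Submodule ℂ V, (∀ g : G, ∀ v ∈ W, ρ g v ∈ W) → W = ⊥ ∨ W = ⊤) ∧
    ∀ g : G, χ g = LinearMap.trace ℂ V (ρ g)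

/-- A complex operator of finite order `m` has an eigenvalue decomposition computing the traces of
all its powers simultaneously. -/
lemma exists_trace_pow_eq_sum {V : Type*} [AddCommGroup V] [Module ℂ V] [FiniteDimensional ℂ V]
    {m : ℕ} (hm : m ≠ 0) (A : Module.End ℂ V) (hA : A ^ m = 1) :
    ∃ (S : Finset ℂ) (n : ℂ → ℕ), (∀ μ ∈ S, μ ^ m = 1) ∧
      ∀ t : ℕ, LinearMap.trace ℂ V (A ^ t) = ∑ μ ∈ S, (n μ : ℂ) * μ ^ t := by
  classical
  have hss : A.IsSemisimple := by
    refine Module.End.isSemisimple_of_squarefree_aeval_eq_zero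
      (p := (Polynomial.X ^ m - 1 : Polynomial ℂ)) ?_ (by simp [hA])
    exact ((Polynomial.X_pow_sub_one_separable_iff).2 (by exact_mod_cast hm)).squarefree
  have hint : DirectSum.IsInternal A.eigenspace :=
    DirectSum.isInternal_submodule_of_iSupIndep_of_iSup_eq_top
      A.eigenspaces_iSupIndep hss.iSup_eigenspace_eq_top
  have hfin : {μ | A.eigenspace μ ≠ ⊥}.Finite :=
    WellFoundedGT.finite_ne_bot_of_iSupIndep A.eigenspaces_iSupIndep
  have hpow : ∀ (t : ℕ) (μ : ℂ) (v : V), v ∈ A.eigenspace μ → (A ^ t) v = μ ^ t • v := by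
    intro t μ v hv
    rw [Module.End.mem_eigenspace_iff] at hv
    induction t with
    | zero => simp
    | succ t ih => rw [pow_succ, Module.End.mul_apply, hv, map_smul, ih, smul_smul, pow_succ']
  refine ⟨hfin.toFinset, fun μ => Module.finrank ℂ (A.eigenspace μ), ?_, ?_⟩
  · intro μ hμ
    obtain ⟨v, hv, hv0⟩ := Submodule.exists_mem_ne_zero_of_ne_bot (hfin.mem_toFinset.1 hμ)
    have h := hpow m μ v hv
    rw [hA, Module.End.one_apply] at h
    by_contra hne
    have : (μ ^ m - 1) • v = 0 := by rw [sub_smul, one_smul, ← h, sub_self]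
    exact (smul_eq_zero.1 this).elim (fun h' => hne (sub_eq_zero.1 h')) hv0
  · intro t
    have hmaps : ∀ μ, Set.MapsTo (A ^ t) (A.eigenspace μ) (A.eigenspace μ) := by
      intro μ v hv
      rw [hpow t μ v hv]
      exact Submodule.smul_mem _ _ hv
    rw [LinearMap.trace_eq_sum_trace_restrict' hint hfin hmaps]
    refine Finset.sum_congr rfl fun μ _ => ?_
    have : (A ^ t).restrict (hmaps μ) = μ ^ t • LinearMap.id := by
      ext v
      exact hpow t μ v v.2
    rw [this, map_smul, LinearMap.trace_id, smul_eq_mul, mul_comm]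

/-- Galois action on character values: embedding `ζ ↦ ζ ^ t` sends `χ g` to `χ (g ^ t)`. -/
lemma IsIrrChar.mem_and_map {G : Type*} [Group G] [Finite G] {χ : G → ℂ} (hχ : IsIrrChar G χ)
    {ζ : ℂ} (hζ : IsPrimitiveRoot ζ (Monoid.exponent G)) (g : G) :
    ∃ hx : χ g ∈ ℚ⟮ζ⟯, ∀ (t : ℕ) (τ : ℚ⟮ζ⟯ →ₐ[ℚ] ℂ),
      τ ⟨ζ, mem_adjoin_simple_self ℚ ζ⟩ = ζ ^ t → τ ⟨χ g, hx⟩ = χ (g ^ t) := by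
  obtain ⟨V, _, _, _, _, ρ, -, htr⟩ := hχ
  have hm : Monoid.exponent G ≠ 0 := Monoid.exponent_ne_zero_of_finite
  obtain ⟨S, n, hS, hsum⟩ := exists_trace_pow_eq_sum hm (ρ g)
    (by rw [← map_pow, Monoid.pow_exponent_eq_one, map_one])
  have hpow (t : ℕ) : χ (g ^ t) = ∑ μ ∈ S, (n μ : ℂ) * μ ^ t := by
    rw [htr, map_pow, hsum]
  have : NeZero (Monoid.exponent G) := ⟨hm⟩
  have hex : ∀ μ ∈ S, ∃ i : ℕ, ζ ^ i = μ := fun μ hμ =>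
    let ⟨i, _, hi⟩ := hζ.eq_pow_of_pow_eq_one (hS μ hμ); ⟨i, hi⟩
  choose! e he using hex
  let z : ℚ⟮ζ⟯ := ⟨ζ, mem_adjoin_simple_self ℚ ζ⟩
  have hz : χ g = ((∑ μ ∈ S, (n μ : ℚ⟮ζ⟯) * z ^ e μ : ℚ⟮ζ⟯) : ℂ) := by
    have h1 := hpow 1
    rw [pow_one] at h1
    rw [h1]
    push_cast
    exact Finset.sum_congr rfl fun μ hμ => by simp [z, he μ hμ]
  refine ⟨hz ▸ SetLike.coe_mem _, fun t τ hτ => ?_⟩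
  have hz' : (⟨χ g, hz ▸ SetLike.coe_mem _⟩ : ℚ⟮ζ⟯) = ∑ μ ∈ S, (n μ : ℚ⟮ζ⟯) * z ^ e μ :=
    Subtype.ext hz
  rw [hz', hpow, map_sum]
  refine Finset.sum_congr rfl fun μ hμ => ?_
  rw [map_mul, map_natCast, map_pow, hτ, ← pow_mul, mul_comm t, pow_mul, he μ hμ]

open scoped MonoidAlgebra in
/-- The trace function of a simple finite-dimensional `ℂ[G]`-module is an irreducible character. -/
lemma isIrrChar_of_isSimpleModule {G : Type*} [Group G] (M : Type*) [AddCommGroup M] [Module ℂ M]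
    [Module ℂ[G] M] [IsScalarTower ℂ ℂ[G] M] [FiniteDimensional ℂ M] [IsSimpleModule ℂ[G] M] :
    IsIrrChar G fun g => LinearMap.trace ℂ M (Representation.ofModule' (k := ℂ) (G := G) M g) := by
  have hnt : Nontrivial M := IsSimpleModule.nontrivial ℂ[G] M
  let e := (Module.finBasis ℂ M).equivFun
  let ρ := Representation.ofModule' (k := ℂ) (G := G) M
  have hρ : ∀ g v, ρ g v = (MonoidAlgebra.single g (1 : ℂ)) • v := by
    intro g v
    simp [ρ, Representation.ofModule']
  let ρ' : Representation ℂ G (Fin (Module.finrank ℂ M) → ℂ) :=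
    ((e.conjAlgEquiv ℂ : Module.End ℂ M →* _)).comp ρ
  refine ⟨Fin (Module.finrank ℂ M) → ℂ, inferInstance, inferInstance, inferInstance,
    e.symm.toEquiv.nontrivial, ρ', ?_, ?_⟩
  · intro W hW
    have hW' : ∀ (a : ℂ[G]) (v : M), v ∈ W.comap e.toLinearMap → a • v ∈ W.comap e.toLinearMap := by
      intro a v hv
      induction a using MonoidAlgebra.induction_on with
      | of g =>
        have := hW g _ hv
        simpa [ρ', hρ] using this
      | add a b ha hb => rw [add_smul]; exact Submodule.add_mem _ ha hb
      | smul c a ha => rw [smul_assoc]; exact Submodule.smul_mem _ _ ha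
    let N : Submodule ℂ[G] M := { W.comap e.toLinearMap with
      smul_mem' := fun a v hv => hW' a v hv }
    have hN : ∀ v, v ∈ N ↔ e v ∈ W := fun v => Iff.rfl
    rcases eq_bot_or_eq_top N with h | h
    · left
      rw [eq_bot_iff]
      intro w hw
      have : e.symm w ∈ N := (hN _).2 (by simpa using hw)
      rw [h, Submodule.mem_bot] at this
      simpa using this
    · right
      rw [eq_top_iff]
      intro w _
      have : e.symm w ∈ N := h ▸ Submodule.mem_top
      simpa using (hN _).1 this
  · intro g
    exact (LinearMap.trace_conj' (ρ g) e).symm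

open scoped MonoidAlgebra in
/-- The irreducible characters separate class functions. -/
lemma eq_zero_of_forall_sum_irrChar_eq_zero {G : Type*} [Group G] [Fintype G] (f : G → ℂ)
    (hf : ∀ g x, f (g⁻¹ * x * g) = f x)
    (h : ∀ χ : G → ℂ, IsIrrChar G χ → ∑ g, f g * χ g = 0) : f = 0 := by
  let a : ℂ[G] := ∑ g, MonoidAlgebra.single g (f g)
  have : NeZero (Nat.card G : ℂ) := ⟨by simp⟩
  have hcent : ∀ b : ℂ[G], Commute a b := by
    intro b
    induction b using MonoidAlgebra.induction_on with
    | of x =>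
      change a * MonoidAlgebra.single x 1 = MonoidAlgebra.single x 1 * a
      simp only [a, Finset.sum_mul, Finset.mul_sum, MonoidAlgebra.single_mul_single, mul_one,
        one_mul]
      refine Fintype.sum_equiv (MulAut.conj x⁻¹).toEquiv _ _ fun g => ?_
      have := hf x g
      simpa [mul_assoc] using this.symm
    | add b c hb hc => exact hb.add_right hc
    | smul c b hb => exact hb.smul_right c
  have hker : ∀ N : Submodule ℂ[G] ℂ[G], IsSimpleModule ℂ[G] N → ∀ v ∈ N, a * v = 0 := by
    intro N hN v hv
    have : FiniteDimensional ℂ ℂ[G] := inferInstance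
    have : FiniteDimensional ℂ N := inferInstanceAs (FiniteDimensional ℂ (N.restrictScalars ℂ))
    have : Nontrivial N := IsSimpleModule.nontrivial ℂ[G] N
    let φ : Module.End ℂ[G] N :=
      { toFun := fun v => a • v
        map_add' := fun v w => smul_add a v w
        map_smul' := fun b v => by
          rw [RingHom.id_apply, smul_smul, smul_smul, (hcent b).eq] }
    obtain ⟨c, hc⟩ := (IsSimpleModule.algebraMap_end_bijective_of_isAlgClosed ℂ
      (A := ℂ[G]) (V := N)).2 φ
    have hc' : ∀ v : N, a • v = c • v := fun v => (LinearMap.congr_fun hc v).symm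
    have htr : ∑ g, f g • Representation.ofModule' (k := ℂ) (G := G) N g =
        c • (LinearMap.id : N →ₗ[ℂ] N) := by
      ext1 v
      have := hc' v
      rw [LinearMap.smul_apply, LinearMap.id_apply, ← this]
      simp only [a, Finset.sum_smul, LinearMap.sum_apply, LinearMap.smul_apply]
      refine Finset.sum_congr rfl fun g _ => ?_
      have : (MonoidAlgebra.single g (f g) : ℂ[G]) = f g • MonoidAlgebra.single g 1 := by simp
      rw [this, smul_assoc]
      simp [Representation.ofModule']
    have h0 := congrArg (LinearMap.trace ℂ N) htr
    rw [map_sum, map_smul, LinearMap.trace_id] at h0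
    simp only [map_smul, smul_eq_mul] at h0
    rw [h _ (isIrrChar_of_isSimpleModule N)] at h0
    have hc0 : c = 0 := by
      rcases mul_eq_zero.1 h0.symm with h1 | h1
      · exact h1
      · exact absurd (Nat.cast_eq_zero.1 h1) Module.finrank_pos.ne'
    have := congrArg Subtype.val (hc' ⟨v, hv⟩)
    simpa [hc0] using this
  have htop : ∀ v : ℂ[G], v ∈ LinearMap.ker (LinearMap.mulLeft ℂ a) := by
    let P : Submodule ℂ[G] ℂ[G] :=
      { carrier := {v | a * v = 0}
        add_mem' := fun {v w} hv hw => by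
          simp only [Set.mem_ofPred_eq] at *; rw [mul_add, hv, hw, add_zero]
        zero_mem' := mul_zero a
        smul_mem' := fun b v hv => by
          simp only [Set.mem_ofPred_eq, smul_eq_mul] at *
          rw [← mul_assoc, (hcent b).eq, mul_assoc, hv, mul_zero] }
    have hP : P = ⊤ := by
      rw [eq_top_iff, ← IsSemisimpleModule.sSup_simples_eq_top ℂ[G] ℂ[G]]
      exact sSup_le fun N hN v hv => hker N hN v hv
    intro v
    have : v ∈ P := hP ▸ Submodule.mem_top
    exact this
  have ha : a = 0 := by simpa using htop 1
  funext g
  have hg := congrArg (fun b : ℂ[G] => b.coeff g) ha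
  classical
  simpa [a, Finsupp.single_apply] using hg

/-- Raising to the power of a unit modulo the exponent is a permutation of the group. -/
lemma exists_equiv_pow_unit {G : Type*} [Group G] [Finite G] (t : (ZMod (Monoid.exponent G))ˣ) :
    ∃ e : G ≃ G, ∀ g, e g = g ^ (t : ZMod (Monoid.exponent G)).val := by
  have : NeZero (Monoid.exponent G) := ⟨Monoid.exponent_ne_zero_of_finite⟩
  have key : ∀ (s u : (ZMod (Monoid.exponent G))ˣ), s * u = 1 → ∀ g : G,
      (g ^ (s : ZMod (Monoid.exponent G)).val) ^ (u : ZMod (Monoid.exponent G)).val = g := by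
    intro s u hsu g
    rw [← pow_mul]
    conv_rhs => rw [← pow_one g]
    rw [pow_eq_pow_iff_modEq]
    refine Nat.ModEq.of_dvd (Monoid.order_dvd_exponent g) ?_
    rw [← ZMod.natCast_eq_natCast_iff]
    push_cast
    rw [ZMod.natCast_zmod_val, ZMod.natCast_zmod_val, ← Units.val_mul, hsu, Units.val_one]
  exact ⟨⟨_, fun g => g ^ ((t⁻¹ : (ZMod (Monoid.exponent G))ˣ) : ZMod (Monoid.exponent G)).val,
    key t t⁻¹ (mul_inv_cancel t), key t⁻¹ t (inv_mul_cancel t)⟩, fun _ => rfl⟩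

lemma msPow_eq_self_iff {G : Type*} [Group G] [Finite G] [DecidableEq G]
    (t : (ZMod (Monoid.exponent G))ˣ) (X : Multiset G) :
    msPow t X = X ↔
      ∀ g, X.count (g ^ (t : ZMod (Monoid.exponent G)).val) = X.count g := by
  obtain ⟨e, he⟩ := exists_equiv_pow_unit t
  have hcount : ∀ g, (msPow t X).count (e g) = X.count g := by
    intro g
    have : msPow t X = X.map e := Multiset.map_congr rfl fun x _ => (he x).symm
    rw [this, Multiset.count_map_eq_count' _ _ e.injective]
  simp_rw [Multiset.ext, ← e.forall_congr_right (q := fun g => (msPow t X).count g = X.count g),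
    hcount, ← he, eq_comm]

/-- A power map fixes all the character sums of a class function iff it fixes the function. -/
lemma forall_sum_irrChar_pow_eq_iff {G : Type*} [Group G] [Fintype G] (f : G → ℂ)
    (hf : ∀ g x, f (g⁻¹ * x * g) = f x) (t : (ZMod (Monoid.exponent G))ˣ) :
    (∀ χ, IsIrrChar G χ →
        ∑ g, f g * χ (g ^ (t : ZMod (Monoid.exponent G)).val) = ∑ g, f g * χ g) ↔
      ∀ g, f (g ^ (t : ZMod (Monoid.exponent G)).val) = f g := by
  obtain ⟨e, he⟩ := exists_equiv_pow_unit t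
  simp_rw [← he]
  constructor
  · intro h
    have hsymm : ∀ g x, e.symm (g⁻¹ * x * g) = g⁻¹ * e.symm x * g := by
      intro g x
      rw [Equiv.symm_apply_eq, he]
      have := conj_pow (a := g⁻¹) (b := e.symm x)
        (i := (t : ZMod (Monoid.exponent G)).val)
      rw [inv_inv] at this
      rw [this, ← he, Equiv.apply_symm_apply]
    have h0 := eq_zero_of_forall_sum_irrChar_eq_zero (fun g => f (e.symm g) - f g)
      (fun g x => by simp only [hsymm, hf]) (fun χ hχ => by
        simp_rw [sub_mul, Finset.sum_sub_distrib, ← h χ hχ]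
        rw [← e.sum_comp (fun g => f (e.symm g) * χ g)]
        simp)
    intro g
    have := congrFun h0 (e g)
    simp only [Equiv.symm_apply_apply, Pi.zero_apply] at this
    exact (sub_eq_zero.1 this).symm
  · intro h χ _
    rw [← e.sum_comp (fun g => f g * χ g)]
    simp_rw [h]

/-- Galois action on integral combinations of character values. -/
lemma IsIrrChar.sum_mem_and_map {G : Type*} [Group G] [Fintype G] {χ : G → ℂ}
    (hχ : IsIrrChar G χ) {ζ : ℂ} (hζ : IsPrimitiveRoot ζ (Monoid.exponent G)) (f : G → ℤ) :
    ∃ hx : ∑ g, (f g : ℂ) * χ g ∈ ℚ⟮ζ⟯, ∀ (t : ℕ) (τ : ℚ⟮ζ⟯ →ₐ[ℚ] ℂ),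
      τ ⟨ζ, mem_adjoin_simple_self ℚ ζ⟩ = ζ ^ t →
        τ ⟨∑ g, (f g : ℂ) * χ g, hx⟩ = ∑ g, (f g : ℂ) * χ (g ^ t) := by
  choose hx hmap using hχ.mem_and_map hζ
  have hz : ∑ g, (f g : ℂ) * χ g = ((∑ g, (f g : ℚ⟮ζ⟯) * ⟨χ g, hx g⟩ : ℚ⟮ζ⟯) : ℂ) := by
    push_cast
    rfl
  refine ⟨hz ▸ SetLike.coe_mem _, fun t τ hτ => ?_⟩
  have hz' : (⟨∑ g, (f g : ℂ) * χ g, hz ▸ SetLike.coe_mem _⟩ : ℚ⟮ζ⟯) =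
      ∑ g, (f g : ℚ⟮ζ⟯) * ⟨χ g, hx g⟩ := Subtype.ext hz
  rw [hz', map_sum]
  exact Finset.sum_congr rfl fun g _ => by rw [map_mul, map_intCast, hmap g t τ hτ]

lemma multiset_sum_map_eq_sum_count {G : Type*} [Fintype G] [DecidableEq G] (X : Multiset G)
    (χ : G → ℂ) : (X.map χ).sum = ∑ g, (X.count g : ℂ) * χ g := by
  rw [Finset.sum_multiset_map_count]
  simp_rw [nsmul_eq_mul]
  exact Finset.sum_subset (Finset.subset_univ _) fun g _ hg => by
    rw [Multiset.mem_toFinset] at hg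
    simp [hg]

/-- A multiset of a group is conjugation-invariant. -/
def IsConjInvariant {G : Type*} [Group G] (X : Multiset G) : Prop :=
  ∀ g : G, X.map (fun x => g⁻¹ * x * g) = X

lemma inv_mul_mul_injective {G : Type*} [Group G] (g : G) :
    Function.Injective fun x : G => g⁻¹ * x * g := fun x y h => by simpa using h

lemma ConjClosedF.isConjInvariant {G : Type*} [Group G] [DecidableEq G] {T : Finset G}
    (hT : ConjClosedF T) : IsConjInvariant T.val := fun g => by
  conv_rhs => rw [← hT g]
  exact (Finset.image_val_of_injOn (inv_mul_mul_injective g).injOn).symm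

namespace IsConjInvariant

variable {G : Type*} [Group G] {X Y : Multiset G}

lemma add (hX : IsConjInvariant X) (hY : IsConjInvariant Y) : IsConjInvariant (X + Y) :=
  fun g => by rw [Multiset.map_add, hX, hY]

lemma nsmul (n : ℕ) (hX : IsConjInvariant X) : IsConjInvariant (n • X) :=
  fun g => by rw [Multiset.map_nsmul, hX]

lemma msProd (hX : IsConjInvariant X) (hY : IsConjInvariant Y) :
    IsConjInvariant (msProd X Y) := fun g => by
  have : (_root_.msProd X Y).map (fun x => g⁻¹ * x * g) =
      _root_.msProd (X.map fun x => g⁻¹ * x * g) (Y.map fun x => g⁻¹ * x * g) := by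
    simp [_root_.msProd, Multiset.map_bind, Multiset.bind_map, mul_assoc]
  rw [this, hX, hY]

lemma count_conj [DecidableEq G] (hX : IsConjInvariant X) (g x : G) :
    X.count (g⁻¹ * x * g) = X.count x := by
  conv_lhs => rw [← hX g]
  exact Multiset.count_map_eq_count' _ _ (inv_mul_mul_injective g) x

end IsConjInvariant

lemma isCyclotomicExtension_adjoin_rat {m : ℕ} [NeZero m] {ζ : ℂ} (hζ : IsPrimitiveRoot ζ m) :
    IsCyclotomicExtension {m} ℚ ℚ⟮ζ⟯ := by
  change IsCyclotomicExtension {m} ℚ ℚ⟮ζ⟯.toSubalgebra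
  rw [adjoin_simple_toSubalgebra_of_isAlgebraic
    (hζ.isIntegral (NeZero.pos m)).tower_top.isAlgebraic]
  exact hζ.adjoin_isCyclotomicExtension ℚ

/-- The automorphisms of a complex cyclotomic field correspond to the units modulo `m`. -/
lemma exists_equiv_units_cyclotomic {m : ℕ} [NeZero m] {ζ : ℂ} (hζ : IsPrimitiveRoot ζ m) :
    ∃ E : (ℚ⟮ζ⟯ ≃ₐ[ℚ] ℚ⟮ζ⟯) ≃ (ZMod m)ˣ, ∀ σ (t : (ZMod m)ˣ),
      ((σ ⟨ζ, mem_adjoin_simple_self ℚ ζ⟩ : ℚ⟮ζ⟯) : ℂ) = ζ ^ (t : ZMod m).val ↔ E σ = t := by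
  have hcyc := isCyclotomicExtension_adjoin_rat hζ
  let z : ℚ⟮ζ⟯ := ⟨ζ, mem_adjoin_simple_self ℚ ζ⟩
  have hz : IsPrimitiveRoot z m := IsPrimitiveRoot.coe_submonoidClass_iff.1 hζ
  have hfin : FiniteDimensional ℚ ℚ⟮ζ⟯ := IsCyclotomicExtension.finiteDimensional {m} ℚ _
  have hgal : IsGalois ℚ ℚ⟮ζ⟯ := IsCyclotomicExtension.isGalois {m} ℚ _
  have hbij : Function.Bijective (hz.autToPow ℚ) := by
    refine (hz.autToPow_injective (K := ℚ)).bijective_of_nat_card_le ?_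
    rw [IsGalois.card_aut_eq_finrank, IsCyclotomicExtension.finrank (n := m) ℚ⟮ζ⟯
      (Polynomial.cyclotomic.irreducible_rat (NeZero.pos m)), Nat.card_eq_fintype_card,
      ZMod.card_units_eq_totient]
  refine ⟨Equiv.ofBijective _ hbij, fun σ t => ?_⟩
  have hspec : ((σ z : ℚ⟮ζ⟯) : ℂ) = ζ ^ ((hz.autToPow ℚ σ : (ZMod m)ˣ) : ZMod m).val := by
    rw [← hz.autToPow_spec ℚ σ]
    rfl
  rw [hspec]
  constructor
  · intro h
    exact Units.ext (ZMod.val_injective m (hζ.pow_inj (ZMod.val_lt (hz.autToPow ℚ σ).val)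
      (ZMod.val_lt (t : ZMod m)) h))
  · rintro rfl
    rfl

/-- An automorphism fixes an adjoined subfield iff it fixes the generators. -/
lemma forall_mem_adjoin_fixed_iff {L : IntermediateField ℚ ℂ} {S : Set ℂ} (hS : adjoin ℚ S ≤ L)
    (σ : L ≃ₐ[ℚ] L) :
    (∀ x (hx : x ∈ adjoin ℚ S), ((σ ⟨x, hS hx⟩ : L) : ℂ) = x) ↔
      ∀ x (hx : x ∈ S), ((σ ⟨x, hS (subset_adjoin ℚ S hx)⟩ : L) : ℂ) = x := by
  refine ⟨fun h x hx => h x (subset_adjoin ℚ S hx),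
    fun h x hx => ?_⟩
  induction hx using adjoin_induction with
  | mem x hx => exact h x hx
  | algebraMap q =>
    have := congrArg Subtype.val (σ.commutes q)
    exact this
  | add x y hx hy ihx ihy =>
    have := congrArg Subtype.val (map_add σ ⟨x, hS hx⟩ ⟨y, hS hy⟩)
    exact this.trans (congrArg₂ (· + ·) ihx ihy)
  | mul x y hx hy ihx ihy =>
    have := congrArg Subtype.val (map_mul σ ⟨x, hS hx⟩ ⟨y, hS hy⟩)
    exact this.trans (congrArg₂ (· * ·) ihx ihy)
  | inv x hx ihx =>
    have := congrArg Subtype.val (map_inv₀ σ ⟨x, hS hx⟩)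
    exact this.trans (congrArg (·⁻¹) ihx)

/-- Galois correspondence for a subextension `K / F` of a Galois extension `L / F`. -/
lemma finrank_extendScalars_eq_and_mem_iff {F E : Type*} [Field F] [Field E] [Algebra F E]
    {K L : IntermediateField F E} (hle : K ≤ L) [FiniteDimensional F L] [IsGalois F L] :
    Module.finrank K (extendScalars hle) =
        Nat.card {σ : L ≃ₐ[F] L // ∀ x (hx : x ∈ K), ((σ ⟨x, hle hx⟩ : L) : E) = x} ∧
      ∀ x : L, (x : E) ∈ K ↔ ∀ σ : L ≃ₐ[F] L,
        (∀ y (hy : y ∈ K), ((σ ⟨y, hle hy⟩ : L) : E) = y) → σ x = x := by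
  have hfix : ∀ σ : L ≃ₐ[F] L, σ ∈ (restrict hle).fixingSubgroup ↔
      ∀ y (hy : y ∈ K), ((σ ⟨y, hle hy⟩ : L) : E) = y := by
    intro σ
    rw [IntermediateField.mem_fixingSubgroup_iff]
    refine ⟨fun h y hy => congrArg Subtype.val (h ⟨y, hle hy⟩ ((mem_restrict hle _).2 hy)),
      fun h y hy => Subtype.ext (h y ((mem_restrict hle y).1 hy))⟩
  constructor
  · have h1 : Nat.card (restrict hle).fixingSubgroup = Module.finrank (restrict hle) L :=
      IsGalois.card_fixingSubgroup_eq_finrank _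
    have h2 : Module.finrank K (extendScalars hle) = Module.finrank (restrict hle) L :=
      Algebra.finrank_eq_of_equiv_equiv (restrictAlgEquiv hle).toRingEquiv (RingEquiv.refl L) rfl
    rw [h2, ← h1]
    exact Nat.card_congr (Equiv.subtypeEquivRight hfix)
  · intro x
    simp_rw [← mem_restrict hle, ← hfix]
    conv_lhs => rw [← IsGalois.fixedField_fixingSubgroup (restrict hle)]
    exact mem_fixedField_iff _ _

theorem stmt_10 {G : Type*} [Group G] [Fintype G] [DecidableEq G]
    (T11 T22 T12 T21 : Finset G)
    (h11 : ConjClosedF T11) (h22 : ConjClosedF T22)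
    (h12 : ConjClosedF T12) (h21 : ConjClosedF T21)
    (I1 I2 I3 : Multiset G)
    (hI1 : I1 = T11.val + T22.val)
    (hI2 : I2 = msProd T11.val T11.val + msProd T22.val T22.val + 4 • msProd T12.val T21.val)
    (hI3 : I3 = 2 • msProd T11.val T22.val)
    (ζ : ℂ) (hζ : IsPrimitiveRoot ζ (Monoid.exponent G))
    (K : IntermediateField ℚ ℂ)
    (hK : K = IntermediateField.adjoin ℚ
      ({z : ℂ | ∃ χ : G → ℂ, IsIrrChar G χ ∧ z = (I1.map χ).sum}
        ∪ {z : ℂ | ∃ χ : G → ℂ, IsIrrChar G χ ∧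
            z = ((I2 - I3).map χ).sum - ((I3 - I2).map χ).sum}))
    (T : Set (ZMod (Monoid.exponent G))ˣ)
    (hT : T = {t | msPow t I1 = I1 ∧ msPow t (I2 - I3) = I2 - I3
        ∧ msPow t (I3 - I2) = I3 - I2}) :
    ∃ hle : K ≤ ℚ⟮ζ⟯,
      Module.finrank ↥K ↥(IntermediateField.extendScalars hle) = Nat.card T
      ∧ ∀ x : ℂ, (x ∈ K ↔ ∃ hx : x ∈ ℚ⟮ζ⟯, ∀ t ∈ T, ∀ σ : ℚ⟮ζ⟯ ≃ₐ[ℚ] ℚ⟮ζ⟯,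
          ((σ ⟨ζ, IntermediateField.mem_adjoin_simple_self ℚ ζ⟩ : ℚ⟮ζ⟯) : ℂ)
              = ζ ^ ((t : ZMod (Monoid.exponent G)).val) →
            ((σ ⟨x, hx⟩ : ℚ⟮ζ⟯) : ℂ) = x) := by
  have hne : NeZero (Monoid.exponent G) := ⟨Monoid.exponent_ne_zero_of_finite⟩
  have hcyc := isCyclotomicExtension_adjoin_rat hζ
  have c11 := h11.isConjInvariant
  have c22 := h22.isConjInvariant
  have cI1 : IsConjInvariant I1 := hI1 ▸ c11.add c22
  have cI2 : IsConjInvariant I2 := hI2 ▸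
    ((c11.msProd c11).add (c22.msProd c22)).add
      ((h12.isConjInvariant.msProd h21.isConjInvariant).nsmul 4)
  have cI3 : IsConjInvariant I3 := hI3 ▸ (c11.msProd c22).nsmul 2
  let f₁ : G → ℤ := fun g => I1.count g
  let f₂ : G → ℤ := fun g => (I2.count g : ℤ) - I3.count g
  have cf₁ : ∀ g x, (f₁ (g⁻¹ * x * g) : ℂ) = f₁ x := fun g x => by
    simp only [f₁, cI1.count_conj]
  have cf₂ : ∀ g x, (f₂ (g⁻¹ * x * g) : ℂ) = f₂ x := fun g x => by
    simp only [f₂, cI2.count_conj, cI3.count_conj]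
  have sum₁ (χ : G → ℂ) : (I1.map χ).sum = ∑ g, (f₁ g : ℂ) * χ g := by
    rw [multiset_sum_map_eq_sum_count]
    simp [f₁]
  have sum₂ (χ : G → ℂ) : ((I2 - I3).map χ).sum - ((I3 - I2).map χ).sum =
      ∑ g, (f₂ g : ℂ) * χ g := by
    rw [multiset_sum_map_eq_sum_count, multiset_sum_map_eq_sum_count, ← Finset.sum_sub_distrib]
    refine Finset.sum_congr rfl fun g _ => ?_
    rw [← sub_mul, Multiset.count_sub, Multiset.count_sub]
    congr 1
    have : ((I2.count g - I3.count g : ℕ) : ℤ) - ((I3.count g - I2.count g : ℕ) : ℤ) = f₂ g := by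
      simp only [f₂]
      omega
    exact_mod_cast congrArg (Int.cast : ℤ → ℂ) this
  have hmemT : ∀ t, t ∈ T ↔
      (∀ g, (f₁ (g ^ (t : ZMod (Monoid.exponent G)).val) : ℂ) = f₁ g) ∧
      (∀ g, (f₂ (g ^ (t : ZMod (Monoid.exponent G)).val) : ℂ) = f₂ g) := by
    intro t
    rw [hT, Set.mem_ofPred_eq, msPow_eq_self_iff, msPow_eq_self_iff, msPow_eq_self_iff,
      ← forall_and]
    refine and_congr (forall_congr' fun g => by simp [f₁]) (forall_congr' fun g => ?_)
    rw [Int.cast_inj]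
    simp only [f₂, Multiset.count_sub]
    omega
  subst hK
  have hle : adjoin ℚ
      ({z : ℂ | ∃ χ : G → ℂ, IsIrrChar G χ ∧ z = (I1.map χ).sum}
        ∪ {z : ℂ | ∃ χ : G → ℂ, IsIrrChar G χ ∧
            z = ((I2 - I3).map χ).sum - ((I3 - I2).map χ).sum}) ≤ ℚ⟮ζ⟯ := by
    rw [adjoin_le_iff]
    rintro z (⟨χ, hχ, rfl⟩ | ⟨χ, hχ, rfl⟩)
    · rw [sum₁]
      exact (hχ.sum_mem_and_map hζ f₁).1
    · rw [sum₂]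
      exact (hχ.sum_mem_and_map hζ f₂).1
  have hfix : ∀ (σ : ℚ⟮ζ⟯ ≃ₐ[ℚ] ℚ⟮ζ⟯) (t : (ZMod (Monoid.exponent G))ˣ),
      ((σ ⟨ζ, mem_adjoin_simple_self ℚ ζ⟩ : ℚ⟮ζ⟯) : ℂ) =
        ζ ^ (t : ZMod (Monoid.exponent G)).val →
      ((∀ x (hx : x ∈ adjoin ℚ _), ((σ ⟨x, hle hx⟩ : ℚ⟮ζ⟯) : ℂ) = x) ↔ t ∈ T) := by
    intro σ t hσ
    have hsum (f : G → ℤ) (χ : G → ℂ) (hχ : IsIrrChar G χ)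
        (hx : ∑ g, (f g : ℂ) * χ g ∈ ℚ⟮ζ⟯) : ((σ ⟨_, hx⟩ : ℚ⟮ζ⟯) : ℂ) =
          ∑ g, (f g : ℂ) * χ (g ^ (t : ZMod (Monoid.exponent G)).val) :=
      (hχ.sum_mem_and_map hζ f).2 _ ((ℚ⟮ζ⟯.val).comp (σ : ℚ⟮ζ⟯ →ₐ[ℚ] ℚ⟮ζ⟯)) hσ
    rw [forall_mem_adjoin_fixed_iff hle σ, hmemT,
      ← forall_sum_irrChar_pow_eq_iff (fun g => (f₁ g : ℂ)) cf₁,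
      ← forall_sum_irrChar_pow_eq_iff (fun g => (f₂ g : ℂ)) cf₂]
    constructor
    · intro h
      constructor
      · intro χ hχ
        have := h _ (Or.inl ⟨χ, hχ, (sum₁ χ).symm⟩)
        rwa [hsum f₁ χ hχ] at this
      · intro χ hχ
        have := h _ (Or.inr ⟨χ, hχ, (sum₂ χ).symm⟩)
        rwa [hsum f₂ χ hχ] at this
    · rintro ⟨h₁, h₂⟩ x hx
      have hxL := hle (subset_adjoin ℚ _ hx)
      change ((σ ⟨x, hxL⟩ : ℚ⟮ζ⟯) : ℂ) = x
      rcases hx with ⟨χ, hχ, hxe⟩ | ⟨χ, hχ, hxe⟩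
      · rw [sum₁] at hxe
        subst hxe
        rw [hsum f₁ χ hχ, h₁ χ hχ]
      · rw [sum₂] at hxe
        subst hxe
        rw [hsum f₂ χ hχ, h₂ χ hχ]
  obtain ⟨e, he⟩ := exists_equiv_units_cyclotomic hζ
  have hfin : FiniteDimensional ℚ ℚ⟮ζ⟯ := IsCyclotomicExtension.finiteDimensional
    {Monoid.exponent G} ℚ _
  have hgal : @IsGalois ℚ _ ℚ⟮ζ⟯ _ ℚ⟮ζ⟯.algebra' := IsCyclotomicExtension.isGalois
    {Monoid.exponent G} ℚ ℚ⟮ζ⟯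
  obtain ⟨hcard, hmem⟩ := finrank_extendScalars_eq_and_mem_iff hle
  refine ⟨hle, hcard.trans (Nat.card_congr (e.subtypeEquiv fun σ => ?_)), fun x => ?_⟩
  · exact hfix σ (e σ) ((he σ (e σ)).2 rfl)
  · constructor
    · intro hx
      exact ⟨hle hx, fun t ht σ hσ => (hfix σ t hσ).2 ht x hx⟩
    · rintro ⟨hx, h⟩
      refine (hmem ⟨x, hx⟩).2 fun σ hσ => Subtype.ext ?_
      have hσe := (he σ (e σ)).2 rfl
      exact h (e σ) ((hfix σ (e σ) hσe).1 hσ) σ hσe
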